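/- arXiv:2211.00456 — 10 statements merged into one kernel-verified Lean document; each statement's English description precedes it below -/
import Mathlib

section
/- Let R be a semidistributive left nearring. Then for all elements r, s ∈ R, (−r)·s = −(r·s). -/
/-- A left nearring: `(R,+)` is a (not necessarily abelian) group, `(R,·)` is a
semigroup, and the left distributive law `x·(y+z) = x·y + x·z` holds. -/
class LeftNearring (R : Type*) extends AddGroup R, Semigroup R where
  left_distrib : ∀ x y z : R, x * (y + z) = x * y + x * z

/-- A left nearring with a multiplicative identity, i.e. `(R,·)` is a monoid. -/
class LeftNearringWithOne (R : Type*) extends LeftNearring R, Monoid R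

/-- In a semidistributive left nearring, `(-r) * s = -(r * s)`. -/
theorem stmt3 (R : Type*) [LeftNearring R]
    (hsd : ∀ r s t : R, (r + s + r) * t = r * t + s * t + r * t)
    (r s : R) :
    (-r) * s = -(r * s) := by
  have h := hsd r (-r) s
  rw [add_neg_cancel, zero_add, add_assoc, left_eq_add] at h
  exact eq_neg_of_add_eq_zero_left h
end

section
/- Let R be a semidistributive left nearring. If r ∈ R has odd (finite) additive order, then 0·r = 0. -/
/-- Left multiplication as an additive homomorphism. -/
def LeftNearring.mulLeftHom {R : Type*} [LeftNearring R] (x : R) : R →+ R :=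
  AddMonoidHom.mk' (x * ·) (LeftNearring.left_distrib x)

/-- In a semidistributive left nearring, if `r` has odd (finite) additive
order, then `0 * r = 0`. -/
theorem stmt5 (R : Type*) [LeftNearring R]
    (hsd : ∀ r s t : R, (r + s + r) * t = r * t + s * t + r * t)
    (r : R) (hodd : Odd (addOrderOf r)) :
    (0 : R) * r = 0 := by
  have h2 : (2 : ℕ) • ((0 : R) * r) = 0 := by
    have h := hsd 0 0 r
    rw [add_zero, add_zero, add_assoc, left_eq_add] at h
    rw [two_nsmul, h]
  have hn : addOrderOf r • ((0 : R) * r) = 0 := by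
    have h := map_nsmul (LeftNearring.mulLeftHom (0 : R)) (addOrderOf r) r
    rw [addOrderOf_nsmul_eq_zero, map_zero] at h
    exact h.symm
  obtain ⟨k, hk⟩ := hodd
  rwa [hk, add_nsmul, mul_comm, mul_nsmul', h2, nsmul_zero, zero_add, one_nsmul] at hn
end

section
/- Let R be a semidistributive left nearring, let r, s ∈ R, and let n be an odd positive integer. Then (n·r)·s = n·(r·s), where n·x denotes the n-fold additive multiple of x. -/
/-- In a semidistributive left nearring, `(n • r) * s = n • (r * s)` for every
odd positive integer `n`. -/
theorem stmt6 (R : Type*) [LeftNearring R]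
    (hsd : ∀ r s t : R, (r + s + r) * t = r * t + s * t + r * t)
    (r s : R) (n : ℕ) (hn : Odd n) :
    (n • r) * s = n • (r * s) := by
  obtain ⟨k, rfl⟩ := hn
  have step (x : R) (m : ℕ) : (m + 2) • x = x + m • x + x := by
    rw [← succ_nsmul', ← succ_nsmul]
  induction k with
  | zero => simp
  | succ k ih =>
    rw [show 2 * (k + 1) + 1 = (2 * k + 1) + 2 by ring, step, step, hsd, ih]
end

section
/- Let R be a semidistributive left nearring, let r, s ∈ R, and let n be an even positive integer. Then (n·r)·s = n·(r·s) + 0·s, where n·x denotes the n-fold additive multiple of x. -/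
/-- In a semidistributive left nearring, `0 * s` has order dividing two. -/
theorem zero_mul_add_zero_mul {R : Type*} [LeftNearring R]
    (hsd : ∀ r s t : R, (r + s + r) * t = r * t + s * t + r * t) (s : R) :
    (0 : R) * s + 0 * s = 0 := by
  have h := hsd 0 0 s
  rw [add_zero, add_zero, add_assoc] at h
  exact left_eq_add.mp h

/-- In a semidistributive left nearring, `0 * s` commutes additively with `r * s`. -/
theorem addCommute_zero_mul {R : Type*} [LeftNearring R]
    (hsd : ∀ r s t : R, (r + s + r) * t = r * t + s * t + r * t) (r s : R) :
    AddCommute ((0 : R) * s) (r * s) := by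
  have h := hsd 0 r s
  rw [zero_add, add_zero] at h
  calc 0 * s + r * s = 0 * s + r * s + (0 * s + 0 * s) := by
        rw [zero_mul_add_zero_mul hsd, add_zero]
    _ = r * s + 0 * s := by rw [← add_assoc, ← h]

/-- In a semidistributive left nearring, `(n • r) * s = n • (r * s) + 0 * s`
for every even positive integer `n`. -/
theorem stmt7 (R : Type*) [LeftNearring R]
    (hsd : ∀ r s t : R, (r + s + r) * t = r * t + s * t + r * t)
    (r s : R) (n : ℕ) (hn : Even n) (hpos : 0 < n) :
    (n • r) * s = n • (r * s) + (0 : R) * s := by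
  obtain ⟨k, rfl⟩ := hn
  rw [← two_mul]
  clear hpos
  induction k with
  | zero => simp
  | succ k ih =>
    have h : (2 * (k + 1)) • r = r + (2 * k) • r + r := by
      rw [← succ_nsmul', ← succ_nsmul, mul_add]
    rw [h, hsd, ih, ← add_assoc, add_assoc _ (0 * s),
      (addCommute_zero_mul hsd r s).eq, ← add_assoc, ← succ_nsmul', ← succ_nsmul, mul_add_one]
    rfl
end

section
/- Let R be a semidistributive left nearring with a multiplicative identity. Then the additive group (R,+) is abelian. -/
/-- In a semidistributive left nearring with identity, left multiplication by `-1` is negation. -/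
theorem LeftNearringWithOne.neg_one_mul_of_semidistrib {R : Type*} [LeftNearringWithOne R]
    (hsd : ∀ r s t : R, (r + s + r) * t = r * t + s * t + r * t) (t : R) :
    (-1 : R) * t = -t := by
  have h := hsd 1 (-1) t
  rw [add_neg_cancel, zero_add, one_mul] at h
  exact (neg_eq_of_add_eq_zero_right (right_eq_add.mp h)).symm

/-- The additive group of every semidistributive left nearring with a
multiplicative identity is abelian. -/
theorem stmt9 (R : Type*) [LeftNearringWithOne R]
    (hsd : ∀ r s t : R, (r + s + r) * t = r * t + s * t + r * t)
    (a b : R) :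
    a + b = b + a := by
  have neg_mul := LeftNearringWithOne.neg_one_mul_of_semidistrib hsd
  have h := LeftNearring.left_distrib (-1 : R) b a
  rw [neg_mul, neg_mul, neg_mul, ← neg_add_rev] at h
  exact (neg_injective h).symm
end

section
/- Let R be a semidistributive left nearring with a multiplicative identity whose additive group is torsion-free. Then the right distributive law (r+s)·t = r·t + s·t holds for all r, s, t ∈ R; consequently R is an associative ring. -/
/-- A map of groups satisfying `f (r + s + r) = f r + f s + f r` preserves zero, provided
the codomain has no element of order two. -/
theorem semihom_zero {G H : Type*} [AddGroup G] [AddGroup H] (f : G → H)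
    (hf : ∀ r s, f (r + s + r) = f r + f s + f r)
    (h2 : ∀ x : H, x + x = 0 → x = 0) : f 0 = 0 := by
  have h := hf 0 0
  rw [add_zero, add_zero, add_assoc] at h
  exact h2 _ (left_eq_add.mp h)

/-- A map of groups satisfying `f (r + s + r) = f r + f s + f r` preserves negation. -/
theorem semihom_neg {G H : Type*} [AddGroup G] [AddGroup H] (f : G → H)
    (hf : ∀ r s, f (r + s + r) = f r + f s + f r) (r : G) : f (-r) = -f r := by
  have h := hf r (-r)
  rw [add_neg_cancel, zero_add] at h
  exact (neg_eq_of_add_eq_zero_right (right_eq_add.mp h)).symm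

/-- A map of commutative groups satisfying `f (r + s + r) = f r + f s + f r` is additive,
provided the codomain has no element of order two. -/
theorem semihom_add {G H : Type*} [AddCommGroup G] [AddCommGroup H] (f : G → H)
    (hf : ∀ r s, f (r + s + r) = f r + f s + f r)
    (h2 : ∀ x : H, x + x = 0 → x = 0) (r s : G) : f (r + s) = f r + f s := by
  have h0 := semihom_zero f hf h2
  have double (x : G) : f (x + x) = f x + f x := by
    simpa [h0] using hf x 0
  have h : f (r + s) + f (r + s) = f r + f s + (f r + f s) := by
    rw [← double, show r + s + (r + s) = r + (s + s) + r by abel, hf, double]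
    abel
  refine sub_eq_zero.mp (h2 _ ?_)
  rw [sub_add_sub_comm, h, sub_self]

/-- A semidistributive left nearring with identity has commutative addition. -/
theorem LeftNearringWithOne.add_comm_of_semidistrib {R : Type*} [LeftNearringWithOne R]
    (hsd : ∀ r s t : R, (r + s + r) * t = r * t + s * t + r * t) (a b : R) :
    a + b = b + a := by
  have neg_one_mul' (t : R) : (-1) * t = -t := by
    rw [semihom_neg (· * t) (fun r s => hsd r s t), one_mul]
  have h := LeftNearring.left_distrib (-1) (-b) (-a)
  simp only [neg_one_mul', neg_add_rev, neg_neg] at h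
  exact h

/-- A semidistributive left nearring with identity whose additive group is
torsion-free satisfies the right distributive law, hence is an associative
ring (its addition is also commutative). -/
theorem stmt11 (R : Type*) [LeftNearringWithOne R]
    (hsd : ∀ r s t : R, (r + s + r) * t = r * t + s * t + r * t)
    (htf : ∀ (x : R) (n : ℕ), 0 < n → n • x = 0 → x = 0) :
    (∀ r s t : R, (r + s) * t = r * t + s * t) ∧
      (∀ a b : R, a + b = b + a) := by
  have comm := LeftNearringWithOne.add_comm_of_semidistrib hsd
  let _ : AddCommGroup R := { (inferInstance : AddGroup R) with add_comm := comm }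
  refine ⟨fun r s t => semihom_add (· * t) (fun r s => hsd r s t) (fun x hx => ?_) r s, comm⟩
  exact htf x 2 two_pos ((two_nsmul x).trans hx)
end

section
/- Let R be a semidistributive left nearring with a multiplicative identity, and let t ∈ R be an element of odd (finite) additive order. Then t is distributive in R, i.e., (r+s)·t = r·t + s·t for all r, s ∈ R. -/
namespace LeftNearring

variable {R : Type*}

/-- Left multiplication by `x` as an endomorphism of the additive group. -/
def mulLeftHom_s12 [LeftNearring R] (x : R) : R →+ R :=
  AddMonoidHom.mk' (x * ·) (left_distrib x)

theorem mul_nsmul_eq [LeftNearring R] (x y : R) (n : ℕ) : x * (n • y) = n • (x * y) :=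
  map_nsmul (mulLeftHom_s12 x) n y

theorem mul_zero_eq [LeftNearring R] (x : R) : x * 0 = 0 :=
  map_zero (mulLeftHom_s12 x)

theorem neg_mul_of_semidistrib [LeftNearring R]
    (hsd : ∀ r s t : R, (r + s + r) * t = r * t + s * t + r * t) (r t : R) :
    -r * t = -(r * t) := by
  have h := hsd r (-r) t
  rw [add_neg_cancel, zero_add] at h
  exact (neg_eq_of_add_eq_zero_right (right_eq_add.mp h)).symm

/-- The additive group of a semidistributive left nearring with identity is abelian. -/
theorem add_comm_of_semidistrib [LeftNearringWithOne R]
    (hsd : ∀ r s t : R, (r + s + r) * t = r * t + s * t + r * t) (x y : R) :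
    x + y = y + x := by
  have neg_one_mul' (z : R) : -1 * z = -z := by
    rw [neg_mul_of_semidistrib hsd, one_mul]
  have h := left_distrib (-1 : R) x y
  rw [neg_one_mul', neg_one_mul', neg_one_mul', ← neg_add_rev] at h
  exact neg_injective h

end LeftNearring

/-- In a semidistributive left nearring with identity, every element of odd
(finite) additive order is distributive. -/
theorem stmt12 (R : Type*) [LeftNearringWithOne R]
    (hsd : ∀ r s t : R, (r + s + r) * t = r * t + s * t + r * t)
    (t : R) (ht : Odd (addOrderOf t)) :
    ∀ r s : R, (r + s) * t = r * t + s * t := by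
  intro r s
  let _ : AddCommGroup R :=
    { (inferInstance : AddGroup R) with add_comm := LeftNearring.add_comm_of_semidistrib hsd }
  have hord (x : R) : addOrderOf t • (x * t) = 0 := by
    rw [← LeftNearring.mul_nsmul_eq, addOrderOf_nsmul_eq_zero, LeftNearring.mul_zero_eq]
  obtain ⟨k, hk⟩ := ht
  have cancel_two (d : R) (hd : addOrderOf t • d = 0) (h2 : 2 • d = 0) : d = 0 := by
    rwa [hk, add_nsmul, mul_comm, mul_nsmul', h2, nsmul_zero, zero_add, one_nsmul] at hd
  have hzero : (0 : R) * t = 0 := by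
    refine cancel_two _ (hord 0) ?_
    have h := hsd 0 0 t
    rw [add_zero, add_zero, add_assoc, left_eq_add] at h
    rw [two_nsmul, h]
  have hdouble (x : R) : (x + x) * t = x * t + x * t := by
    simpa [hzero] using hsd x 0 t
  rw [← sub_eq_zero]
  refine cancel_two _ ?_ ?_
  · rw [nsmul_sub, nsmul_add, hord, hord, hord, add_zero, sub_zero]
  · have h := hsd r (s + s) t
    rw [show r + (s + s) + r = (r + s) + (r + s) by abel, hdouble, hdouble] at h
    rw [nsmul_sub, two_nsmul, h]
    abel
end

section
/- Let R be a finite semidistributive left nearring with a multiplicative identity whose cardinality is odd. Then the right distributive law (r+s)·t = r·t + s·t holds for all r, s, t ∈ R; consequently R is an associative ring. -/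
/-- Every element of a finite additive group of odd order is a double. -/
theorem exists_add_self_eq_of_odd_card {G : Type*} [AddGroup G] [Fintype G]
    (h : Odd (Fintype.card G)) (r : G) : ∃ u : G, u + u = r := by
  obtain ⟨k, hk⟩ := h
  refine ⟨(k + 1) • r, ?_⟩
  have hr : (2 * k + 1) • r = 0 := hk ▸ card_nsmul_eq_zero
  rw [← add_nsmul, show k + 1 + (k + 1) = 2 * k + 1 + 1 by ring, succ_nsmul, hr, zero_add]

/-- A finite additive group of odd order has no element of order two. -/
theorem eq_zero_of_add_self_eq_zero_of_odd_card {G : Type*} [AddGroup G] [Fintype G]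
    (h : Odd (Fintype.card G)) {a : G} (ha : a + a = 0) : a = 0 := by
  obtain ⟨k, hk⟩ := h
  have hr : (2 * k + 1) • a = 0 := hk ▸ card_nsmul_eq_zero
  rwa [succ_nsmul, mul_nsmul, two_nsmul, ha, nsmul_zero, zero_add] at hr

/-- A finite semidistributive left nearring with identity of odd order
satisfies the right distributive law, hence is an associative ring. -/
theorem stmt13 (R : Type*) [LeftNearringWithOne R] [Fintype R]
    (hsd : ∀ r s t : R, (r + s + r) * t = r * t + s * t + r * t)
    (hcard : Odd (Fintype.card R)) :
    (∀ r s t : R, (r + s) * t = r * t + s * t) ∧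
      (∀ a b : R, a + b = b + a) := by
  have zero_mul' (t : R) : 0 * t = 0 := by
    have h := hsd 0 0 t
    rw [add_zero, add_zero, add_assoc, left_eq_add] at h
    exact eq_zero_of_add_self_eq_zero_of_odd_card hcard h
  have double_mul (u t : R) : (u + u) * t = u * t + u * t := by
    simpa only [add_zero, zero_mul'] using hsd u 0 t
  -- Doubling is left multiplication by `1 + 1`, hence additive, so addition commutes.
  have comm (a b : R) : a + b = b + a := by
    have h := LeftNearring.left_distrib (1 + 1) b a
    rw [double_mul, double_mul, double_mul, one_mul, one_mul, one_mul, add_assoc, add_assoc,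
      add_left_cancel_iff, ← add_assoc, ← add_assoc, add_right_cancel_iff] at h
    exact h
  refine ⟨fun r s t => ?_, comm⟩
  obtain ⟨u, rfl⟩ := exists_add_self_eq_of_odd_card hcard r
  rw [double_mul, add_assoc, comm u s, ← add_assoc, hsd, add_assoc, comm (s * t), ← add_assoc]
end

section
/- Let R be a semidistributive left nearring with a multiplicative identity, let p be a prime, and let P be the p-component of the additive group R⁺ (the set of elements whose additive order is a power of p). Then P is an ideal of R; that is, P is a subgroup of R⁺ (normal, since R⁺ is abelian), and for all r, s ∈ R and a ∈ P both r·a ∈ P and (r+a)·s − r·s ∈ P. -/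
section SemiEndomorphism

variable {A B : Type*} [AddCommGroup A] [AddCommGroup B] {f : A → B}

theorem semiEndo_add_two_mul_nsmul (hf : ∀ r s, f (r + s + r) = f r + f s + f r)
    (s b : A) (n : ℕ) : f (s + (2 * n) • b) = f s + (2 * n) • f b := by
  induction n with
  | zero => simp
  | succ n ih =>
    have h : s + (2 * (n + 1)) • b = b + (s + (2 * n) • b) + b := by
      rw [mul_add, add_smul, mul_one, two_nsmul]; abel
    rw [h, hf, ih, mul_add, add_smul, mul_one, two_nsmul]; abel

theorem semiEndo_two_mul_nsmul_eq_zero (hf : ∀ r s, f (r + s + r) = f r + f s + f r)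
    {a : A} {m : ℕ} (ha : m • a = 0) : (2 * m) • f a = 0 := by
  have h := semiEndo_add_two_mul_nsmul hf 0 a m
  rw [mul_nsmul', ha, nsmul_zero, add_zero] at h
  exact left_eq_add.mp h

theorem semiEndo_two_nsmul_add_sub (hf : ∀ r s, f (r + s + r) = f r + f s + f r)
    (r a : A) : 2 • (f (r + a) - f r) = 2 • f a := by
  have h₁ := semiEndo_add_two_mul_nsmul hf 0 (r + a) 1
  have h₂ := semiEndo_add_two_mul_nsmul hf (0 + (2 * 1) • a) r 1
  have h₃ := semiEndo_add_two_mul_nsmul hf 0 a 1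
  have h : (0 : A) + (2 * 1) • (r + a) = 0 + (2 * 1) • a + (2 * 1) • r := by
    rw [nsmul_add]; abel
  rw [h, h₂, h₃, add_assoc, add_right_inj, mul_one] at h₁
  rw [nsmul_sub, ← h₁]; abel

theorem semiEndo_exists_pow_nsmul_add_sub (hf : ∀ r s, f (r + s + r) = f r + f s + f r)
    {p : ℕ} (hp : p.Prime) (r : A) {a : A} {k : ℕ} (ha : p ^ k • a = 0) :
    ∃ l : ℕ, p ^ l • (f (r + a) - f r) = 0 := by
  rcases hp.eq_two_or_odd' with rfl | hodd
  · refine ⟨k + 1, ?_⟩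
    rw [pow_succ, mul_nsmul', semiEndo_two_nsmul_add_sub hf, ← mul_nsmul', mul_comm]
    exact semiEndo_two_mul_nsmul_eq_zero hf ha
  · obtain ⟨j, hj⟩ := hodd.pow (n := k)
    refine ⟨k, ?_⟩
    have hb : p ^ k • (-(j • a)) = 0 := by
      rw [smul_neg, ← mul_nsmul', mul_comm, mul_nsmul', ha, nsmul_zero, neg_zero]
    have hab : a = (2 * 1) • (-(j • a)) := by
      rw [hj, add_smul, one_nsmul, mul_nsmul'] at ha
      rw [mul_one, smul_neg]
      exact eq_neg_of_add_eq_zero_right ha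
    have h := semiEndo_add_two_mul_nsmul hf r (-(j • a)) 1
    rw [← hab] at h
    rw [h, add_sub_cancel_left, mul_one, ← mul_nsmul', mul_comm]
    exact semiEndo_two_mul_nsmul_eq_zero hf hb

end SemiEndomorphism

theorem LeftNearringWithOne.add_comm_of_semidistributive {R : Type*} [LeftNearringWithOne R]
    (hsd : ∀ r s t : R, (r + s + r) * t = r * t + s * t + r * t) (x y : R) :
    x + y = y + x := by
  have hneg (t : R) : -1 * t = -t := by
    have h := hsd 1 (-1) t
    rw [add_neg_cancel, zero_add, one_mul] at h
    exact eq_neg_of_add_eq_zero_right (right_eq_add.mp h)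
  have h := LeftNearring.left_distrib (-1 : R) x y
  rw [hneg, hneg, hneg, ← neg_add_rev] at h
  exact (neg_injective h.symm).symm

/-- In a semidistributive left nearring with identity, for each prime `p` the
`p`-component of the additive group (the set of elements annihilated by some
power of `p`) is an ideal: it is a (normal) subgroup of the additive group,
and is closed under left multiplication and under `a ↦ (r + a) * s - r * s`. -/
theorem stmt14 (R : Type*) [LeftNearringWithOne R]
    (hsd : ∀ r s t : R, (r + s + r) * t = r * t + s * t + r * t)
    (p : ℕ) (hp : p.Prime) (P : Set R)
    (hP : P = {x : R | ∃ k : ℕ, p ^ k • x = 0}) :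
    (0 : R) ∈ P ∧
    (∀ a b : R, a ∈ P → b ∈ P → a + b ∈ P) ∧
    (∀ a : R, a ∈ P → -a ∈ P) ∧
    (∀ r a : R, a ∈ P → r + a - r ∈ P) ∧
    (∀ r a : R, a ∈ P → r * a ∈ P) ∧
    (∀ r s a : R, a ∈ P → (r + a) * s - r * s ∈ P) := by
  let : AddCommGroup R :=
    { (inferInstance : AddGroup R) with
      add_comm := LeftNearringWithOne.add_comm_of_semidistributive hsd }
  have hmul (r : R) : ∃ φ : R →+ R, ∀ x, φ x = r * x :=
    ⟨AddMonoidHom.mk' (r * ·) (LeftNearring.left_distrib r), fun _ => rfl⟩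
  subst hP
  refine ⟨⟨0, nsmul_zero _⟩, ?_, ?_, ?_, ?_, ?_⟩
  · rintro a b ⟨k, hk⟩ ⟨l, hl⟩
    refine ⟨k + l, ?_⟩
    have ha : p ^ (k + l) • a = 0 := by rw [pow_add, mul_nsmul, hk, nsmul_zero]
    have hb : p ^ (k + l) • b = 0 := by rw [pow_add, mul_nsmul', hl, nsmul_zero]
    exact (nsmul_add a b _).trans (by rw [ha, hb]; exact add_zero 0)
  · rintro a ⟨k, hk⟩
    exact ⟨k, (neg_nsmul a _).trans (by rw [hk]; exact neg_zero)⟩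
  · rintro r a ⟨k, hk⟩
    refine ⟨k, ?_⟩
    rwa [LeftNearringWithOne.add_comm_of_semidistributive hsd r a, add_sub_cancel_right]
  · rintro r a ⟨k, hk⟩
    obtain ⟨φ, hφ⟩ := hmul r
    refine ⟨k, ?_⟩
    rw [← hφ]
    exact (map_nsmul φ _ a).symm.trans ((congrArg φ hk).trans (map_zero φ))
  · rintro r s a ⟨k, hk⟩
    exact semiEndo_exists_pow_nsmul_add_sub (f := (· * s)) (fun x y => hsd x y s) hp r hk
end

section
/- Let R be a left nearring and G a right R-module such that: (i) G is faithful (Ann_R(G) = 0); (ii) the group (G,+) is abelian; and (iii) for each r ∈ R the map g ↦ g·r is an endomorphism of (G,+). Then the right distributive law (s+t)·r = s·r + t·r holds in R, and consequently R is an associative ring. -/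
/-- Elements of `R` that act identically on a faithful module are equal. -/
theorem eq_of_forall_act_eq {R G : Type*} [AddGroup R] [AddGroup G] {act : G → R → G}
    (hact_add : ∀ (g : G) (r s : R), act g (r + s) = act g r + act g s)
    (hfaithful : ∀ x : R, (∀ g : G, act g x = 0) → x = 0)
    {a b : R} (h : ∀ g : G, act g a = act g b) : a = b := by
  refine sub_eq_zero.mp (hfaithful _ fun g => ?_)
  have key := hact_add g (a - b) b
  rwa [sub_add_cancel, h, right_eq_add] at key

/-- If a left nearring `R` has a faithful right `R`-module `G` whose additive
group is abelian and on which every `r ∈ R` acts as an endomorphism, then the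
right distributive law holds in `R` (and its addition is commutative), so `R`
is an associative ring. -/
theorem stmt16 (R G : Type*) [LeftNearring R] [AddGroup G]
    (act : G → R → G)
    (hact_mul : ∀ (g : G) (r s : R), act (act g r) s = act g (r * s))
    (hact_add : ∀ (g : G) (r s : R), act g (r + s) = act g r + act g s)
    (hfaithful : ∀ x : R, (∀ g : G, act g x = 0) → x = 0)
    (habelian : ∀ g h : G, g + h = h + g)
    (hendo : ∀ (r : R) (g h : G), act (g + h) r = act g r + act h r) :
    (∀ s t r : R, (s + t) * r = s * r + t * r) ∧
      (∀ a b : R, a + b = b + a) := by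
  refine ⟨fun s t r => eq_of_forall_act_eq hact_add hfaithful fun g => ?_,
    fun a b => eq_of_forall_act_eq hact_add hfaithful fun g => ?_⟩
  · rw [← hact_mul, hact_add, hendo, hact_mul, hact_mul, hact_add]
  · rw [hact_add, hact_add, habelian]
end
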